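/- The assignment A ↦ cotype(A) induces a bijection from the set of equivalence classes of EL-charts onto P_{m,n,d}. -/

import Mathlib

namespace ELChart

/-- An EL-chart (for parameters `d`, `n` and `mfun τ = m_τ`): a non-empty subset
`A ⊆ ℤ^(d) = (ℤ/dℤ) × ℤ` which is bounded below and satisfies `f(A) ⊆ A` and `A + n ⊆ A`,
where `f (τ, x) = (τ + 1, x + m_τ)`. -/
def IsChart (d n : ℕ) (mfun : ZMod d → ℤ) (A : Set (ZMod d × ℤ)) : Prop :=
  A.Nonempty ∧ (∃ c : ℤ, ∀ p ∈ A, c ≤ p.2) ∧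
    (∀ p ∈ A, ((p.1 + 1 : ZMod d), p.2 + mfun p.1) ∈ A) ∧
    (∀ p ∈ A, (p.1, p.2 + (n : ℤ)) ∈ A)

/-- `B = A ∖ (A + n)`. -/
def Bset (d n : ℕ) (A : Set (ZMod d × ℤ)) : Set (ZMod d × ℤ) :=
  {p | p ∈ A ∧ (p.1, p.2 - (n : ℤ)) ∉ A}

/-- The shift `A + z` of a subset of `ℤ^(d)`. -/
def shift (d : ℕ) (A : Set (ZMod d × ℤ)) (z : ℤ) : Set (ZMod d × ℤ) :=
  (fun p : ZMod d × ℤ => (p.1, p.2 + z)) '' A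

/-- Two EL-charts are equivalent if they differ by a shift. -/
def ChartEquiv (d : ℕ) (A A' : Set (ZMod d × ℤ)) : Prop :=
  ∃ z : ℤ, shift d A z = A'

/-- The sequence `b 0, b 1, …` associated with an EL-chart: `b 0 = min B_(0)` and `b (i+1)`
is the unique element of `B` of the form `f (b i) − c * n` with `c` a non-negative integer. -/
noncomputable def bseq (d n : ℕ) (mfun : ZMod d → ℤ) (A : Set (ZMod d × ℤ)) :
    ℕ → ZMod d × ℤ
  | 0 => ((0 : ZMod d), sInf {x : ℤ | ((0 : ZMod d), x) ∈ Bset d n A})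
  | i + 1 =>
    ((bseq d n mfun A i).1 + 1,
      sInf {y : ℤ | ((bseq d n mfun A i).1 + 1, y) ∈ Bset d n A ∧
        ((bseq d n mfun A i).2 + mfun (bseq d n mfun A i).1 - y) % (n : ℤ) = 0 ∧
        y ≤ (bseq d n mfun A i).2 + mfun (bseq d n mfun A i).1})

/-- The entry `μ'_k` (for `1 ≤ k ≤ d*n`) of the type of an EL-chart: the non-negative integer
with `b k = f (b (k-1)) − μ'_k * n`. -/
noncomputable def typeInt (d n : ℕ) (mfun : ZMod d → ℤ) (A : Set (ZMod d × ℤ)) (k : ℕ) : ℤ :=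
  ((bseq d n mfun A (k - 1)).2 + mfun (bseq d n mfun A (k - 1)).1
    - (bseq d n mfun A k).2) / (n : ℤ)

/-- The type of an EL-chart as a tuple: `μ'_{τ,i} = μ'_{τ + (i−1)d}` where the `Fin d`-index
`τ` corresponds to `τ + 1 ∈ {1, …, d}` and the `Fin n`-index `i` to `i + 1 ∈ {1, …, n}`. -/
noncomputable def typeTup (d n : ℕ) (mfun : ZMod d → ℤ) (A : Set (ZMod d × ℤ)) :
    Fin d → Fin n → ℤ :=
  fun τ i => typeInt d n mfun A (τ.val + 1 + i.val * d)

/-- The entry `μ'_{τ',i'}` of the type of an EL-chart attached to an element `p = b_{τ',i'}`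
of `B`: if `q ∈ B` is the (unique) predecessor of `p`, i.e. the element with
`p = f q − c * n` for a non-negative integer `c`, then `muOf p = c`. -/
noncomputable def muOf (d n : ℕ) (mfun : ZMod d → ℤ) (A : Set (ZMod d × ℤ))
    (p : ZMod d × ℤ) : ℤ :=
  (sInf {y : ℤ | ((p.1 - 1 : ZMod d), y) ∈ Bset d n A ∧
      (y + mfun (p.1 - 1) - p.2) % (n : ℤ) = 0 ∧ p.2 ≤ y + mfun (p.1 - 1)}
    + mfun (p.1 - 1) - p.2) / (n : ℤ)

/-- The `i`-th largest element `b̃_{τ,i}` of `B_(τ)` (1-indexed: `i ∈ {1, …, n}`): the unique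
element of `B_(τ)` with exactly `i − 1` elements of `B_(τ)` above it. -/
noncomputable def btilde (d n : ℕ) (A : Set (ZMod d × ℤ)) (τ : ZMod d) (i : ℕ) : ℤ :=
  sInf {y : ℤ | (τ, y) ∈ Bset d n A ∧
    Set.ncard {z : ℤ | (τ, z) ∈ Bset d n A ∧ y < z} = i - 1}

/-- The cotype of an EL-chart as a tuple: `μ̃_{τ,i} = μ'_{τ',i'}` where `b̃_{τ,i} = b_{τ',i'}`,
i.e. the type entry attached to the `i`-th largest element of `B_(τ)`. -/
noncomputable def cotypeTup (d n : ℕ) (mfun : ZMod d → ℤ) (A : Set (ZMod d × ℤ)) :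
    Fin d → Fin n → ℤ :=
  fun τ i =>
    muOf d n mfun A (((τ.val + 1 : ℕ) : ZMod d),
      btilde d n A ((τ.val + 1 : ℕ) : ZMod d) (i.val + 1))

/-- Membership in `P_{m,n,d}`: all entries are non-negative and
`Σ_{i=1}^k Σ_{τ=1}^d μ_{τ,i} ≤ k*m/n` for `k = 1, …, n`, with equality for `k = n`. -/
def memP (d n m : ℕ) (μ : Fin d → Fin n → ℤ) : Prop :=
  (∀ τ i, 0 ≤ μ τ i) ∧
    (∀ k : ℕ, 1 ≤ k → k ≤ n →
      (n : ℤ) * ∑ τ : Fin d, ∑ i : Fin n, (if i.val + 1 ≤ k then μ τ i else 0)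
        ≤ (k : ℤ) * (m : ℤ)) ∧
    (∑ τ : Fin d, ∑ i : Fin n, μ τ i) = (m : ℤ)

/-- An EL-chart is normalised if `Σ_{b ∈ B_(0)} |b| = n(n−1)/2`. -/
def IsNormalised (d n : ℕ) (A : Set (ZMod d × ℤ)) : Prop :=
  ∑ᶠ x ∈ {x : ℤ | ((0 : ZMod d), x) ∈ Bset d n A}, x = ((n * (n - 1) / 2 : ℕ) : ℤ)

/-- The dominant rearrangement of a tuple: each component is sorted weakly decreasingly. -/
def domOf (d n : ℕ) (μ : Fin d → Fin n → ℤ) : Fin d → Fin n → ℤ :=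
  fun τ i => μ τ (Tuple.sort (fun j => -(μ τ j)) i)

/-- A tuple is dominant if each of its `d` components is weakly decreasing. -/
def IsDom (d n : ℕ) (μ : Fin d → Fin n → ℤ) : Prop :=
  ∀ τ : Fin d, ∀ i j : Fin n, i ≤ j → μ τ j ≤ μ τ i

end ELChart

namespace ELChart

open Finset

/-! ### Decreasing rearrangements -/

/-- The weakly decreasing rearrangement of an integer vector. -/
def sortDesc {n : ℕ} (v : Fin n → ℤ) : Fin n → ℤ :=
  v ∘ Tuple.sort (fun j => -(v j))

lemma antitone_sortDesc {n : ℕ} (v : Fin n → ℤ) : Antitone (sortDesc v) := fun i j h => by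
  have := Tuple.monotone_sort (fun j => -(v j)) h
  simpa [sortDesc] using this

lemma sortDesc_eq_of_comp_perm {n : ℕ} {u v : Fin n → ℤ} (hu : Antitone u)
    (σ : Equiv.Perm (Fin n)) (h : ∀ i, v i = u (σ i)) : sortDesc v = u := by
  have hv : u = v ∘ σ.symm := by
    funext i
    simp [h]
  conv_rhs => rw [hv]
  exact Tuple.unique_antitone (antitone_sortDesc v) (hv ▸ hu)

lemma le_sortDesc_iff {n : ℕ} (v : Fin n → ℤ) (a : ℤ) (j : Fin n) :
    a ≤ sortDesc v j ↔ j.val < #{i | a ≤ v i} := by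
  rw [← Tuple.lt_card_ge_iff_apply_ge_of_antitone (antitone_sortDesc v)]
  have : #{i | a ≤ sortDesc v i} = #{i | a ≤ v i} :=
    Finset.card_equiv (Tuple.sort (fun j => -(v j))) fun i => by
      simp only [mem_filter, mem_univ, true_and]
      rfl
  rw [this]

lemma sortDesc_mono {n : ℕ} {v w : Fin n → ℤ} (h : v ≤ w) : sortDesc v ≤ sortDesc w := by
  intro j
  rw [le_sortDesc_iff]
  refine lt_of_lt_of_le ((le_sortDesc_iff v _ j).1 le_rfl) (card_le_card ?_)
  intro i hi
  simp only [mem_filter, mem_univ, true_and] at hi ⊢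
  exact hi.trans (h i)

lemma sum_sortDesc {n : ℕ} (v : Fin n → ℤ) : ∑ i, sortDesc v i = ∑ i, v i :=
  Equiv.sum_comp (Tuple.sort (fun j => -(v j))) v

/-- The sum of the first `k` entries of a vector. -/
def topSum {n : ℕ} (k : ℕ) (v : Fin n → ℤ) : ℤ :=
  ∑ i with i.val < k, v i

lemma card_filter_val_lt {n k : ℕ} (hk : k ≤ n) : #{i : Fin n | i.val < k} = k := by
  rw [Fin.card_filter_val_lt, min_eq_right hk]

lemma topSum_zero {n : ℕ} (v : Fin n → ℤ) : topSum 0 v = 0 := by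
  simp [topSum]

lemma topSum_succ {n k : ℕ} (hk : k < n) (v : Fin n → ℤ) :
    topSum (k + 1) v = topSum k v + v ⟨k, hk⟩ := by
  have : ({i | i.val < k + 1} : Finset (Fin n)) = insert (⟨k, hk⟩ : Fin n) ({i | i.val < k} : Finset (Fin n)) := by
    ext i
    simp [Fin.ext_iff]
    omega
  rw [topSum, this, sum_insert (by simp), topSum, add_comm]

lemma topSum_add {n : ℕ} (k : ℕ) (v w : Fin n → ℤ) :
    topSum k (fun i => v i + w i) = topSum k v + topSum k w :=
  sum_add_distrib

lemma sum_le_topSum {n : ℕ} {u : Fin n → ℤ} (hu : Antitone u) (J : Finset (Fin n)) :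
    ∑ i ∈ J, u i ≤ topSum #J u := by
  have hJ : #J ≤ n := by simpa using card_le_univ J
  rcases Nat.eq_zero_or_pos #J with h0 | h0
  · rw [h0, topSum_zero, card_eq_zero.1 h0, sum_empty]
  set t := u ⟨#J - 1, by omega⟩ with ht
  set I : Finset (Fin n) := {i | i.val < #J} with hI
  have hge : ∀ i ∈ I, 0 ≤ u i - t := fun i hi => by
    have : u ⟨#J - 1, by omega⟩ ≤ u i := hu (by
      simp only [hI, mem_filter, mem_univ, true_and] at hi
      simp only [Fin.le_def]; omega)
    linarith
  have hle : ∀ i ∉ I, u i - t ≤ 0 := fun i hi => by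
    have : u i ≤ u ⟨#J - 1, by omega⟩ := hu (by
      simp only [hI, mem_filter, mem_univ, true_and] at hi
      simp only [Fin.le_def]; omega)
    linarith
  have key : ∑ i ∈ J, (u i - t) ≤ ∑ i ∈ I, (u i - t) :=
    calc ∑ i ∈ J, (u i - t) ≤ ∑ i ∈ J ∩ I, (u i - t) := by
          rw [← sum_inter_add_sum_sdiff J I]
          have := sum_nonpos (s := J \ I) (f := fun i => u i - t)
            fun i hi => hle i (mem_sdiff.1 hi).2
          linarith
      _ ≤ ∑ i ∈ I, (u i - t) :=
          sum_le_sum_of_subset_of_nonneg inter_subset_right fun i hi _ => hge i hi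
  have hc : #I = #J := card_filter_val_lt hJ
  simp only [sum_sub_distrib, sum_const, hc] at key
  simpa [topSum] using key

lemma exists_topSum_sortDesc {n k : ℕ} (hk : k ≤ n) (v : Fin n → ℤ) :
    ∃ J : Finset (Fin n), #J = k ∧ topSum k (sortDesc v) = ∑ i ∈ J, v i ∧
      ∀ i ∉ J, ∀ j ∈ J, v i ≤ v j := by
  set σ := Tuple.sort (fun j => -(v j)) with hσ
  refine ⟨({i | i.val < k} : Finset (Fin n)).map σ.toEmbedding, ?_, ?_, ?_⟩
  · rw [card_map, card_filter_val_lt hk]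
  · rw [sum_map]
    rfl
  · intro i hi j hj
    simp only [mem_map_equiv, mem_filter, mem_univ, true_and] at hi hj
    have := antitone_sortDesc v (show σ.symm j ≤ σ.symm i by rw [Fin.le_def]; omega)
    simpa [sortDesc, ← hσ] using this

lemma topSum_le_topSum_sortDesc {n k : ℕ} (hk : k ≤ n) (v : Fin n → ℤ) :
    topSum k v ≤ topSum k (sortDesc v) := by
  set σ := Tuple.sort (fun j => -(v j)) with hσ
  have h := sum_le_topSum (antitone_sortDesc v)
    (({i | i.val < k} : Finset (Fin n)).map σ.symm.toEmbedding)
  rw [card_map, card_filter_val_lt hk, sum_map] at h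
  simpa [sortDesc, ← hσ, topSum] using h

lemma topSum_sortDesc_add {n k : ℕ} (hk : k ≤ n) {u w : Fin n → ℤ} (hu : Antitone u) {L : ℤ}
    (hw0 : ∀ i, 0 ≤ w i) (hwL : ∀ i, w i ≤ L) :
    topSum k (sortDesc fun i => u i + w i) = topSum k u + topSum k w ∨
      ∃ l, k = l + 1 ∧ l + 2 ≤ n ∧ 2 * topSum (l + 1) u ≤ L + topSum l u + topSum (l + 2) u ∧
        topSum k (sortDesc fun i => u i + w i) ≤ topSum k u + k * L := by
  obtain ⟨J, hJ, hsum, htop⟩ := exists_topSum_sortDesc hk fun i => u i + w i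
  by_cases hJk : J = ({i | i.val < k} : Finset (Fin n))
  · left
    rw [hsum, hJk, sum_add_distrib]
    rfl
  right
  have hcard := card_filter_val_lt hk
  have h1 : ∃ j ∈ J, k ≤ j.val := by
    by_contra! h
    exact hJk (eq_of_subset_of_card_le (fun j hj => by simpa using h j hj) (by omega))
  have h2 : ∃ i ∉ J, i.val < k := by
    by_contra! h
    refine hJk (eq_of_subset_of_card_le (fun j hj => ?_) (by omega)).symm
    by_contra hjJ
    have := h j hjJ
    simp at hj
    omega
  obtain ⟨j, hjJ, hj⟩ := h1
  obtain ⟨i, hiJ, hi⟩ := h2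
  obtain ⟨l, rfl⟩ : ∃ l, k = l + 1 := ⟨k - 1, by omega⟩
  have hjn := j.2
  refine ⟨l, rfl, by omega, ?_, ?_⟩
  · have a1 := topSum_succ (show l < n by omega) u
    have a2 := topSum_succ (show l + 1 < n by omega) u
    have a3 : u ⟨l, by omega⟩ ≤ u i := hu (by rw [Fin.le_def]; simp only; omega)
    have a4 : u j ≤ u ⟨l + 1, by omega⟩ := hu (by rw [Fin.le_def]; simp only; omega)
    have a5 := htop i hiJ j hjJ
    have a6 := hw0 i
    have a7 := hwL j
    linarith
  · rw [hsum, sum_add_distrib]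
    have b1 := sum_le_topSum hu J
    have b2 : ∑ i ∈ J, w i ≤ ∑ i ∈ J, L := sum_le_sum fun i _ => hwL i
    rw [sum_const, hJ, nsmul_eq_mul] at b2
    rw [hJ] at b1
    linarith

/-! ### Sums over a cycle -/

lemma bijective_natCast_fin (d : ℕ) [NeZero d] :
    Function.Bijective fun t : Fin d => ((t.val : ℕ) : ZMod d) := by
  rw [Fintype.bijective_iff_injective_and_card]
  refine ⟨fun s t h => ?_, by simp⟩
  have := congrArg ZMod.val h
  simp only [ZMod.val_cast_of_lt s.2, ZMod.val_cast_of_lt t.2] at this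
  exact Fin.ext this

lemma sum_fin_natCast (d : ℕ) [NeZero d] (g : ZMod d → ℤ) :
    ∑ t : Fin d, g ((t.val : ℕ) : ZMod d) = ∑ τ, g τ :=
  (bijective_natCast_fin d).sum_comp g

lemma sum_add_left {d : ℕ} [NeZero d] (τ : ZMod d) (g : ZMod d → ℤ) :
    ∑ σ, g (τ + σ) = ∑ σ, g σ :=
  Equiv.sum_comp (Equiv.addLeft τ) g

lemma sum_range_natCast (d : ℕ) [NeZero d] (g : ZMod d → ℤ) :
    ∑ s ∈ range d, g (s : ZMod d) = ∑ τ, g τ := by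
  rw [Finset.sum_range, ← sum_fin_natCast]

lemma sum_fin_natCast_succ (d : ℕ) [NeZero d] (g : ZMod d → ℤ) :
    ∑ t : Fin d, g ((t.val + 1 : ℕ) : ZMod d) = ∑ τ, g τ := by
  rw [← sum_add_left 1 g, ← sum_fin_natCast]
  simp [add_comm]

lemma exists_natCast_succ_eq {d : ℕ} [NeZero d] (τ : ZMod d) :
    ∃ t : Fin d, ((t.val + 1 : ℕ) : ZMod d) = τ := by
  obtain ⟨t, ht⟩ := (bijective_natCast_fin d).2 (τ - 1)
  simp only at ht
  exact ⟨t, by rw [Nat.cast_succ, ht, sub_add_cancel]⟩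

/-- A function on a cycle with non-positive sum is dominated by a difference function. -/
lemma exists_potential {d : ℕ} [NeZero d] (δ : ZMod d → ℤ) (h : ∑ τ, δ τ ≤ 0) :
    ∃ a : ZMod d → ℤ, (∀ τ, 0 ≤ a τ) ∧ ∀ τ, a (τ + 1) + δ τ ≤ a τ := by
  set b : ZMod d → ℤ := fun τ => ∑ s ∈ range τ.val, δ (s : ZMod d) with hb
  have hstep : ∀ τ, b τ + δ τ ≤ b (τ + 1) := by
    intro τ
    have hτ : b τ + δ τ = ∑ s ∈ range (τ.val + 1), δ (s : ZMod d) := by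
      rw [sum_range_succ, ZMod.natCast_zmod_val]
    rw [hτ]
    have hlt := ZMod.val_lt τ
    have hcast : τ + 1 = ((τ.val + 1 : ℕ) : ZMod d) := by simp
    rcases Nat.lt_or_ge (τ.val + 1) d with h1 | h1
    · simp only [hb]
      rw [hcast, ZMod.val_cast_of_lt h1]
    · have h2 : τ.val + 1 = d := by omega
      have h3 : τ + 1 = 0 := by rw [hcast, h2, ZMod.natCast_self]
      simp only [hb, h2, h3, ZMod.val_zero, range_zero, sum_empty, sum_range_natCast, h]
  obtain ⟨K, hK⟩ := Finite.exists_le b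
  exact ⟨fun τ => K - b τ, fun τ => by linarith [hK τ], fun τ => by linarith [hstep τ]⟩

/-! ### The sorting dynamics attached to a cotype -/

/-- The self-map `x ↦ (sort (x_(τ+1) + n ν_(τ+1)) − m_τ)_τ`, whose fixed points are the
enumerations in decreasing order of the sets `B` of EL-charts with cotype `ν`. -/
def step {d n : ℕ} (mfun : ZMod d → ℤ) (ν x : ZMod d → Fin n → ℤ) : ZMod d → Fin n → ℤ :=
  fun τ i => sortDesc (fun j => x (τ + 1) j + n * ν (τ + 1) j) i - mfun τ

lemma step_mono {d n : ℕ} (mfun : ZMod d → ℤ) (ν : ZMod d → Fin n → ℤ) :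
    Monotone (step mfun ν) := by
  intro x y h τ i
  have : (fun j => x (τ + 1) j + n * ν (τ + 1) j) ≤ fun j => y (τ + 1) j + n * ν (τ + 1) j :=
    fun j => add_le_add_left (h (τ + 1) j) _
  exact sub_le_sub_right (sortDesc_mono this i) _

lemma antitone_step {d n : ℕ} (mfun : ZMod d → ℤ) (ν x : ZMod d → Fin n → ℤ) (τ : ZMod d) :
    Antitone (step mfun ν x τ) :=
  fun _ _ h => sub_le_sub_right (antitone_sortDesc _ h) _

lemma step_add_const {d n : ℕ} (mfun : ZMod d → ℤ) (ν x : ZMod d → Fin n → ℤ) (c : ℤ) :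
    step mfun ν (fun τ i => x τ i + c) = fun τ i => step mfun ν x τ i + c := by
  funext τ i
  have : sortDesc (fun j => x (τ + 1) j + c + n * ν (τ + 1) j) =
      fun i => sortDesc (fun j => x (τ + 1) j + n * ν (τ + 1) j) i + c :=
    sortDesc_eq_of_comp_perm (fun _ _ h => add_le_add_left (antitone_sortDesc _ h) _)
      (Tuple.sort (fun j => -(x (τ + 1) j + n * ν (τ + 1) j))).symm
      fun i => by simp [sortDesc]; ring
  simp only [step, this]
  ring

lemma sum_step_apply {d n : ℕ} (mfun : ZMod d → ℤ) (ν x : ZMod d → Fin n → ℤ) (τ : ZMod d) :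
    ∑ i, step mfun ν x τ i = ∑ i, x (τ + 1) i + n * ∑ i, ν (τ + 1) i - n * mfun τ := by
  simp only [step, sum_sub_distrib, sum_sortDesc, sum_add_distrib, mul_sum, sum_const, card_univ,
    Fintype.card_fin, nsmul_eq_mul]

lemma sum_add_one {d : ℕ} [NeZero d] (g : ZMod d → ℤ) : ∑ τ, g (τ + 1) = ∑ τ, g τ :=
  Equiv.sum_comp (Equiv.addRight 1) g

lemma sum_step {d n : ℕ} [NeZero d] (mfun : ZMod d → ℤ) (ν x : ZMod d → Fin n → ℤ) :
    ∑ τ, ∑ i, step mfun ν x τ i =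
      ∑ τ, ∑ i, x τ i + n * ∑ τ, ∑ i, ν τ i - n * ∑ τ, mfun τ := by
  simp only [sum_step_apply, sum_sub_distrib, sum_add_distrib, ← mul_sum]
  rw [sum_add_one fun τ => ∑ i, x τ i, sum_add_one fun τ => ∑ i, ν τ i]

lemma step_eq_of_le_step {d n : ℕ} [NeZero d] {mfun : ZMod d → ℤ} {ν x : ZMod d → Fin n → ℤ}
    (hν : ∑ τ, ∑ i, ν τ i = ∑ τ, mfun τ) (h : x ≤ step mfun ν x) : step mfun ν x = x := by
  have hs := sum_step mfun ν x
  rw [hν, add_sub_cancel_right] at hs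
  have h1 := (sum_eq_sum_iff_of_le (fun τ _ => sum_le_sum fun i _ => h τ i)).1 hs.symm
  funext τ i
  exact ((sum_eq_sum_iff_of_le (fun i _ => h τ i)).1 (h1 τ (mem_univ τ)) i (mem_univ i)).symm

lemma sum_eq_of_step_eq {d n : ℕ} [NeZero d] (hn : 0 < n) {mfun : ZMod d → ℤ}
    {ν x : ZMod d → Fin n → ℤ} (hx : step mfun ν x = x) : ∑ τ, ∑ i, ν τ i = ∑ τ, mfun τ := by
  have hs := sum_step mfun ν x
  rw [hx] at hs
  have hn' : (n : ℤ) ≠ 0 := by exact_mod_cast hn.ne'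
  exact mul_left_cancel₀ hn' (by linarith)

lemma step_sup_eq {d n : ℕ} [NeZero d] {mfun : ZMod d → ℤ} {ν x y : ZMod d → Fin n → ℤ}
    (hν : ∑ τ, ∑ i, ν τ i = ∑ τ, mfun τ) (hx : step mfun ν x = x) (hy : step mfun ν y = y) :
    step mfun ν (x ⊔ y) = x ⊔ y :=
  step_eq_of_le_step hν <| sup_le (hx.symm.le.trans (step_mono mfun ν le_sup_left))
    (hy.symm.le.trans (step_mono mfun ν le_sup_right))

/-! ### Residues of fixed points -/

/-- The number of entries of `v` in the residue class `r` modulo `n`. -/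
def residueCount {n : ℕ} (v : Fin n → ℤ) (r : ZMod n) : ℕ :=
  #{i | ((v i : ℤ) : ZMod n) = r}

lemma residueCount_add_one {d n : ℕ} {mfun : ZMod d → ℤ} {ν x : ZMod d → Fin n → ℤ}
    (hx : step mfun ν x = x) (τ : ZMod d) (r : ZMod n) :
    residueCount (x (τ + 1)) r = residueCount (x τ) (r - (mfun τ : ℤ)) := by
  have h : ∀ i, sortDesc (fun j => x (τ + 1) j + n * ν (τ + 1) j) i = x τ i + mfun τ := fun i => by
    rw [← congrFun (congrFun hx τ) i, step, sub_add_cancel]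
  refine (Finset.card_equiv (Tuple.sort fun j => -(x (τ + 1) j + n * ν (τ + 1) j)) fun i => ?_).symm
  have := congrArg (Int.cast : ℤ → ZMod n) (h i)
  simp only [sortDesc, Function.comp, Int.cast_add, Int.cast_mul, Int.cast_natCast,
    CharP.cast_eq_zero, zero_mul, add_zero] at this
  simp only [mem_filter, mem_univ, true_and, this, eq_sub_iff_add_eq]

lemma residueCount_add_natCast {d n : ℕ} {mfun : ZMod d → ℤ} {ν x : ZMod d → Fin n → ℤ}
    (hx : step mfun ν x = x) (τ : ZMod d) (t : ℕ) (r : ZMod n) :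
    residueCount (x (τ + t)) r =
      residueCount (x τ) (r - ((∑ s ∈ range t, mfun (τ + s) : ℤ) : ZMod n)) := by
  induction t generalizing r with
  | zero => simp
  | succ t ih =>
    rw [Nat.cast_succ, ← add_assoc, residueCount_add_one hx, ih, sum_range_succ]
    congr 1
    push_cast
    ring

lemma residueCount_eq_one {d n m : ℕ} [NeZero d] (hn : 0 < n) (hmn : Nat.Coprime m n)
    {mfun : ZMod d → ℤ} (hsum : ∑ τ, mfun τ = (m : ℤ)) {ν x : ZMod d → Fin n → ℤ}
    (hx : step mfun ν x = x) (τ : ZMod d) (r : ZMod n) : residueCount (x τ) r = 1 := by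
  have : NeZero n := ⟨hn.ne'⟩
  have hshift : ∀ s : ZMod n, residueCount (x τ) s = residueCount (x τ) (s - m) := fun s => by
    have := residueCount_add_natCast hx τ d s
    rw [sum_range_natCast d fun σ => mfun (τ + σ), sum_add_left, hsum] at this
    simpa using this
  have hmul : ∀ (k : ℕ) (s : ZMod n),
      residueCount (x τ) s = residueCount (x τ) (s - k * m) := by
    intro k
    induction k with
    | zero => simp
    | succ k ih =>
      intro s
      rw [ih, hshift]
      congr 1
      push_cast
      ring
  have hconst : ∀ s : ZMod n, residueCount (x τ) s = residueCount (x τ) r := fun s => by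
    rw [hmul ((s - r) * (m : ZMod n)⁻¹).val s]
    congr 1
    rw [ZMod.natCast_zmod_val, mul_assoc, mul_comm _ (m : ZMod n), ZMod.coe_mul_inv_eq_one m hmn]
    ring
  have htot : ∑ s : ZMod n, residueCount (x τ) s = n := by
    have := card_eq_sum_card_fiberwise (s := (univ : Finset (Fin n))) (t := univ)
      (f := fun i => ((x τ i : ℤ) : ZMod n)) (fun _ _ => by simp)
    simpa [residueCount] using this.symm
  simp only [hconst, sum_const, card_univ, ZMod.card, smul_eq_mul] at htot
  exact Nat.eq_of_mul_eq_mul_left hn (by omega)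

lemma residue_bijective {d n m : ℕ} [NeZero d] (hn : 0 < n) (hmn : Nat.Coprime m n)
    {mfun : ZMod d → ℤ} (hsum : ∑ τ, mfun τ = (m : ℤ)) {ν x : ZMod d → Fin n → ℤ}
    (hx : step mfun ν x = x) (τ : ZMod d) :
    Function.Bijective fun i => ((x τ i : ℤ) : ZMod n) := by
  have : NeZero n := ⟨hn.ne'⟩
  rw [Fintype.bijective_iff_injective_and_card]
  refine ⟨fun i j hij => ?_, by simp⟩
  refine card_le_one.1 (residueCount_eq_one hn hmn hsum hx τ (x τ j : ℤ)).le i ?_ j ?_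
  · simpa using hij
  · simp

/-! ### Uniqueness of the fixed point up to translation -/

lemma forall_le_or_forall_lt_of_step_eq {d n m : ℕ} [NeZero d] (hn : 0 < n)
    (hmn : Nat.Coprime m n) {mfun : ZMod d → ℤ} (hsum : ∑ τ, mfun τ = (m : ℤ))
    {ν x y : ZMod d → Fin n → ℤ} (hx : step mfun ν x = x) (hy : step mfun ν y = y)
    (τ : ZMod d) (c : ℤ) :
    (∀ i, x τ i ≤ y τ i + c) ∨ ∀ i, y τ i + c < x τ i := by
  have : NeZero n := ⟨hn.ne'⟩
  have hν := sum_eq_of_step_eq hn hx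
  have hres : ∀ e : ℤ, ((∑ i, max (x τ i) (y τ i + e) : ℤ) : ZMod n) = ∑ r : ZMod n, r := by
    intro e
    have hye : step mfun ν (fun τ i => y τ i + e) = fun τ i => y τ i + e := by
      rw [step_add_const, hy]
    have hb := residue_bijective hn hmn hsum (step_sup_eq hν hx hye) τ
    rw [← hb.sum_comp fun r => r, Int.cast_sum]
    rfl
  have hdiff : ∑ i, max (x τ i) (y τ i + (c + 1)) - ∑ i, max (x τ i) (y τ i + c) =
      (#{i | x τ i ≤ y τ i + c} : ℤ) := by
    rw [← sum_sub_distrib, card_filter, Nat.cast_sum]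
    refine sum_congr rfl fun i _ => ?_
    split_ifs with h
    · rw [max_eq_right h, max_eq_right (by omega)]
      push_cast
      ring
    · rw [max_eq_left (by omega), max_eq_left (by omega)]
      simp
  have hdvd : n ∣ #{i | x τ i ≤ y τ i + c} := by
    rw [← ZMod.natCast_eq_zero_iff, ← Int.cast_natCast, ← hdiff, Int.cast_sub, hres, hres, sub_self]
  rcases Nat.eq_zero_or_pos #{i | x τ i ≤ y τ i + c} with h0 | h0
  · right
    intro i
    by_contra! h
    have := card_eq_zero.1 h0
    have hi : i ∈ ({i | x τ i ≤ y τ i + c} : Finset (Fin n)) := by simpa using h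
    rw [this] at hi
    simp at hi
  · left
    have hle := Nat.le_of_dvd h0 hdvd
    have huniv := eq_univ_of_card ({i | x τ i ≤ y τ i + c} : Finset (Fin n))
      (le_antisymm (card_le_univ _) (by simpa using hle))
    intro i
    have : i ∈ ({i | x τ i ≤ y τ i + c} : Finset (Fin n)) := by
      rw [huniv]
      exact mem_univ i
    simpa using this

lemma exists_eq_add_of_step_eq {d n m : ℕ} [NeZero d] (hn : 0 < n)
    (hmn : Nat.Coprime m n) {mfun : ZMod d → ℤ} (hsum : ∑ τ, mfun τ = (m : ℤ))
    {ν x y : ZMod d → Fin n → ℤ} (hx : step mfun ν x = x) (hy : step mfun ν y = y) :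
    ∃ c : ℤ, x = fun τ i => y τ i + c := by
  have hcomp : ∀ τ, ∃ c : ℤ, ∀ i, x τ i = y τ i + c := by
    intro τ
    set i₀ : Fin n := ⟨0, hn⟩
    refine ⟨x τ i₀ - y τ i₀, fun i => ?_⟩
    have h1 := forall_le_or_forall_lt_of_step_eq hn hmn hsum hx hy τ (x τ i₀ - y τ i₀)
    have h2 := forall_le_or_forall_lt_of_step_eq hn hmn hsum hx hy τ (x τ i₀ - y τ i₀ - 1)
    have h1' := (h1.resolve_right fun h => by have := h i₀; omega) i
    have h2' := (h2.resolve_left fun h => by have := h i₀; omega) i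
    omega
  choose c hc using hcomp
  have hn' : (n : ℤ) ≠ 0 := by exact_mod_cast hn.ne'
  have hstep : ∀ τ, c (τ + 1) = c τ := by
    intro τ
    have h1 := sum_step_apply mfun ν x τ
    have h2 := sum_step_apply mfun ν y τ
    rw [hx] at h1
    rw [hy] at h2
    simp only [hc, sum_add_distrib, sum_const, card_univ, Fintype.card_fin, nsmul_eq_mul] at h1
    exact mul_left_cancel₀ hn' (by linarith)
  have hconst : ∀ t : ℕ, c (t : ZMod d) = c 0 := by
    intro t
    induction t with
    | zero => simp
    | succ t ih => rw [Nat.cast_succ, hstep, ih]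
  refine ⟨c 0, funext fun τ => funext fun i => ?_⟩
  rw [hc, ← hconst τ.val, ZMod.natCast_zmod_val]

/-! ### Existence of a fixed point -/

lemma exists_le_map_of_finite_orbit {α : Type*} [Lattice α] {f : α → α} (hf : Monotone f) (x : α)
    {S : Set α} (hS : S.Finite) (h : ∀ t, f^[t] x ∈ S) : ∃ z, z ≤ f z := by
  obtain ⟨s, t, hst, heq⟩ := hS.exists_lt_map_eq_of_forall_mem h
  obtain ⟨p, rfl⟩ := Nat.exists_eq_add_of_lt hst
  have hne : (range (p + 1)).Nonempty := ⟨0, by simp⟩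
  set g : ℕ → α := fun k => f^[s + k] x with hg
  have hsucc : ∀ k, g (k + 1) = f (g k) := fun k => by
    exact Function.iterate_succ_apply' f (s + k) x
  refine ⟨(range (p + 1)).sup' hne g, sup'_le _ _ fun k hk => ?_⟩
  rcases k with _ | k
  · have : g 0 = f (g p) := by rw [← hsucc]; exact heq
    rw [this]
    exact hf (le_sup' g (by simp))
  · rw [hsucc]
    exact hf (le_sup' g (by simp at hk ⊢; omega))

lemma topSum_step {d n k : ℕ} (hk : k ≤ n) (mfun : ZMod d → ℤ) (ν x : ZMod d → Fin n → ℤ)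
    (τ : ZMod d) : topSum k (step mfun ν x τ) =
      topSum k (sortDesc fun j => x (τ + 1) j + n * ν (τ + 1) j) - k * mfun τ := by
  simp only [topSum, step, sum_sub_distrib, sum_const, card_filter_val_lt hk, nsmul_eq_mul]

/-- The partial sum condition keeps the orbit of `0` in a bounded region. -/
lemma exists_topSum_bound_invariant {d n m : ℕ} [NeZero d] {mfun : ZMod d → ℤ}
    (hsum : ∑ τ, mfun τ = (m : ℤ)) {ν : ZMod d → Fin n → ℤ} (h0 : ∀ τ i, 0 ≤ ν τ i)
    (htot : ∑ τ, ∑ i, ν τ i = (m : ℤ))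
    (hP : ∀ k ≤ n, (n : ℤ) * ∑ τ, topSum k (ν τ) ≤ k * m) :
    ∃ B : ℕ → ZMod d → ℤ, (∀ k ≤ n, ∀ τ, 0 ≤ B k τ) ∧
      ∀ x : ZMod d → Fin n → ℤ, (∀ τ, Antitone (x τ)) → (∀ k ≤ n, ∀ τ, topSum k (x τ) ≤ B k τ) →
        ∀ k ≤ n, ∀ τ, topSum k (step mfun ν x τ) ≤ B k τ := by
  have hpot : ∀ k : ℕ, ∃ a : ZMod d → ℤ, k ≤ n → (∀ τ, 0 ≤ a τ) ∧
      ∀ τ, a (τ + 1) + (n * topSum k (ν (τ + 1)) - k * mfun τ) ≤ a τ := by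
    intro k
    by_cases hk : k ≤ n
    · obtain ⟨a, ha⟩ := exists_potential (fun τ => n * topSum k (ν (τ + 1)) - k * mfun τ) (by
        rw [sum_sub_distrib, ← mul_sum, ← mul_sum, sum_add_one fun τ => topSum k (ν τ), hsum]
        linarith [hP k hk])
      exact ⟨a, fun _ => ha⟩
    · exact ⟨0, fun h => absurd h hk⟩
  choose a ha using hpot
  obtain ⟨A, hA⟩ := Finite.exists_le fun p : Fin (n + 1) × ZMod d => a p.1 p.2
  have hA' : ∀ k ≤ n, ∀ τ, a k τ ≤ A := fun k hk τ => hA (⟨k, by omega⟩, τ)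
  have hA0 : 0 ≤ A := ((ha 0 (Nat.zero_le n)).1 0).trans (hA' 0 (Nat.zero_le n) 0)
  obtain ⟨K, hK⟩ := Finite.exists_le fun τ : ZMod d => |mfun τ|
  have hK0 : 0 ≤ K := (abs_nonneg _).trans (hK 0)
  have hνm : ∀ τ i, ν τ i ≤ m := fun τ i => by
    rw [← htot]
    exact (single_le_sum (fun i _ => h0 τ i) (mem_univ i)).trans
      (single_le_sum (f := fun τ => ∑ i, ν τ i)
        (fun τ _ => sum_nonneg fun i _ => h0 τ i) (mem_univ τ))
  set L : ℤ := n * m with hL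
  have hL0 : 0 ≤ L := by positivity
  set H : ℤ := L + A + n * L + n * K with hH
  have hH0 : 0 ≤ H := by positivity
  refine ⟨fun k τ => H * (k * (n - k)) + a k τ, fun k hk τ => ?_, ?_⟩
  · have : (0 : ℤ) ≤ n - k := by have : (k : ℤ) ≤ n := by exact_mod_cast hk
                                 linarith
    have := (ha k hk).1 τ
    positivity
  intro x hx hB k hk τ
  rw [topSum_step hk]
  have hwL : ∀ i, (n : ℤ) * ν (τ + 1) i ≤ L := fun i =>
    mul_le_mul_of_nonneg_left (hνm _ i) (by positivity)
  have hw0 : ∀ i, 0 ≤ (n : ℤ) * ν (τ + 1) i := fun i => mul_nonneg (by positivity) (h0 _ i)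
  rcases topSum_sortDesc_add hk (hx (τ + 1)) hw0 hwL with h | ⟨l, rfl, hl, hgap, hle⟩
  · have hmul : topSum k (fun i => (n : ℤ) * ν (τ + 1) i) = n * topSum k (ν (τ + 1)) := by
      simp only [topSum, mul_sum]
    rw [h, hmul]
    have h1 := hB k hk (τ + 1)
    have h2 := (ha k hk).2 τ
    simp only at h1
    linarith
  · have h1 := hB l (by omega) (τ + 1)
    have h2 := hB (l + 2) hl (τ + 1)
    have h3 := hA' l (by omega) (τ + 1)
    have h4 := hA' (l + 2) hl (τ + 1)
    have h5 := (ha (l + 1) hk).1 τ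
    have hk' : ((l + 1 : ℕ) : ℤ) ≤ n := by exact_mod_cast hk
    have h6 : ((l + 1 : ℕ) : ℤ) * L ≤ n * L := mul_le_mul_of_nonneg_right hk' hL0
    have h7 : -(((l + 1 : ℕ) : ℤ) * mfun τ) ≤ n * K :=
      calc -(((l + 1 : ℕ) : ℤ) * mfun τ) = ((l + 1 : ℕ) : ℤ) * -mfun τ := by ring
        _ ≤ ((l + 1 : ℕ) : ℤ) * K :=
          mul_le_mul_of_nonneg_left ((neg_le_abs _).trans (hK τ)) (by positivity)
        _ ≤ n * K := mul_le_mul_of_nonneg_right hk' hK0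
    have h8 : H * ((l : ℕ) * (n - (l : ℕ))) + H * ((l + 2 : ℕ) * (n - (l + 2 : ℕ))) =
        2 * (H * ((l + 1 : ℕ) * (n - (l + 1 : ℕ)))) - 2 * H := by
      push_cast
      ring
    simp only at h1 h2
    linarith

lemma exists_step_eq {d n m : ℕ} [NeZero d] (hn : 0 < n) {mfun : ZMod d → ℤ}
    (hsum : ∑ τ, mfun τ = (m : ℤ)) {ν : ZMod d → Fin n → ℤ} (h0 : ∀ τ i, 0 ≤ ν τ i)
    (htot : ∑ τ, ∑ i, ν τ i = (m : ℤ))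
    (hP : ∀ k ≤ n, (n : ℤ) * ∑ τ, topSum k (ν τ) ≤ k * m) :
    ∃ x, step mfun ν x = x := by
  obtain ⟨B, hB0, hB⟩ := exists_topSum_bound_invariant hsum h0 htot hP
  have hinv : ∀ t : ℕ, (∀ τ, Antitone ((step mfun ν)^[t] 0 τ)) ∧
      (∀ k ≤ n, ∀ τ, topSum k ((step mfun ν)^[t] 0 τ) ≤ B k τ) ∧
      ∑ τ, ∑ i, (step mfun ν)^[t] 0 τ i = 0 := by
    intro t
    induction t with
    | zero =>
      refine ⟨fun τ => antitone_const, fun k hk τ => ?_, by simp⟩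
      simpa [topSum] using hB0 k hk τ
    | succ t ih =>
      rw [Function.iterate_succ_apply']
      refine ⟨antitone_step mfun ν _, hB _ ih.1 ih.2.1, ?_⟩
      rw [sum_step, ih.2.2, htot, hsum]
      ring
  obtain ⟨U, hU⟩ := Finite.exists_le (B 1)
  have hU0 : 0 ≤ U := (hB0 1 hn 0).trans (hU 0)
  have hupper : ∀ t τ i, (step mfun ν)^[t] 0 τ i ≤ U := by
    intro t τ i
    have h1 := (hinv t).2.1 1 hn τ
    rw [topSum_succ hn, topSum_zero, zero_add] at h1
    exact ((hinv t).1 τ (Fin.le_def.2 (Nat.zero_le _))).trans (h1.trans (hU τ))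
  have hlower : ∀ t τ i, -(d * n * U) ≤ (step mfun ν)^[t] 0 τ i := by
    intro t τ i
    have h1 := (hinv t).2.2
    have h2 : U - (step mfun ν)^[t] 0 τ i ≤ ∑ τ, ∑ i, (U - (step mfun ν)^[t] 0 τ i) :=
      (single_le_sum (f := fun i => U - (step mfun ν)^[t] 0 τ i)
        (fun i _ => sub_nonneg.2 (hupper t τ i)) (mem_univ i)).trans
      (single_le_sum (f := fun τ => ∑ i, (U - (step mfun ν)^[t] 0 τ i))
        (fun τ _ => sum_nonneg fun i _ => sub_nonneg.2 (hupper t τ i)) (mem_univ τ))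
    simp only [sum_sub_distrib, h1, sum_const, card_univ, Fintype.card_fin, ZMod.card,
      nsmul_eq_mul] at h2
    linarith
  obtain ⟨z, hz⟩ := exists_le_map_of_finite_orbit (step_mono mfun ν) 0
    (Set.finite_Icc (fun _ _ => -(d * n * U)) fun _ _ => U)
    fun t => ⟨fun τ i => hlower t τ i, fun τ i => hupper t τ i⟩
  exact ⟨z, step_eq_of_le_step (htot.trans hsum.symm) hz⟩

/-- The partial sum condition is necessary for the existence of a fixed point. -/
lemma sum_topSum_le_of_step_eq {d n m k : ℕ} [NeZero d] (hk : k ≤ n) {mfun : ZMod d → ℤ}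
    (hsum : ∑ τ, mfun τ = (m : ℤ)) {ν x : ZMod d → Fin n → ℤ} (hx : step mfun ν x = x) :
    (n : ℤ) * ∑ τ, topSum k (ν τ) ≤ k * m := by
  have h : ∀ τ, topSum k (x (τ + 1)) + n * topSum k (ν (τ + 1)) ≤
      topSum k (x τ) + k * mfun τ := by
    intro τ
    have h1 := topSum_step hk mfun ν x τ
    have h2 := topSum_le_topSum_sortDesc hk fun j => x (τ + 1) j + n * ν (τ + 1) j
    have h3 : topSum k (fun i => (n : ℤ) * ν (τ + 1) i) = n * topSum k (ν (τ + 1)) := by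
      simp only [topSum, mul_sum]
    rw [topSum_add, h3] at h2
    rw [hx] at h1
    linarith
  have := sum_le_sum fun τ (_ : τ ∈ univ) => h τ
  rw [sum_add_distrib, sum_add_distrib, ← mul_sum, ← mul_sum, sum_add_one fun τ => topSum k (x τ),
    sum_add_one fun τ => topSum k (ν τ), hsum] at this
  linarith

/-! ### Charts and fixed points -/

/-- The set generated under translation by `n` by the entries of `x`. -/
def chartOf {d n : ℕ} (x : ZMod d → Fin n → ℤ) : Set (ZMod d × ℤ) :=
  {p | ∃ i, ∃ N : ℕ, p.2 = x p.1 i + N * n}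

lemma mem_Bset_chartOf {d n : ℕ} (hn : 0 < n) {x : ZMod d → Fin n → ℤ}
    (hinj : ∀ τ, Function.Injective fun i => ((x τ i : ℤ) : ZMod n)) (τ : ZMod d) (y : ℤ) :
    (τ, y) ∈ Bset d n (chartOf x) ↔ ∃ i, y = x τ i := by
  constructor
  · rintro ⟨⟨i, N, hN⟩, hB⟩
    rcases N with _ | N
    · exact ⟨i, by simpa using hN⟩
    · refine absurd ⟨i, N, ?_⟩ hB
      simp only at hN ⊢
      rw [hN]
      push_cast
      ring
  · rintro ⟨i, rfl⟩
    refine ⟨⟨i, 0, by simp⟩, ?_⟩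
    rintro ⟨j, N, hN⟩
    simp only at hN
    have hij : i = j := hinj τ (by
      have := congrArg (Int.cast : ℤ → ZMod n) hN
      simpa using this)
    subst hij
    have h1 : (0 : ℤ) ≤ N * n := by positivity
    omega

lemma btilde_chartOf {d n : ℕ} (hn : 0 < n) {x : ZMod d → Fin n → ℤ}
    (hinj : ∀ τ, Function.Injective fun i => ((x τ i : ℤ) : ZMod n)) {τ : ZMod d}
    (hx : StrictAnti (x τ)) (i : Fin n) :
    btilde d n (chartOf x) τ (i.val + 1) = x τ i := by
  have hcard : ∀ j, Set.ncard {z : ℤ | (τ, z) ∈ Bset d n (chartOf x) ∧ x τ j < z} = j.val := by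
    intro j
    have : {z : ℤ | (τ, z) ∈ Bset d n (chartOf x) ∧ x τ j < z} =
        ((Finset.Iio j).image (x τ) : Finset ℤ) := by
      ext z
      simp only [mem_Bset_chartOf hn hinj, Set.mem_ofPred_eq, coe_image, Set.mem_image, coe_Iio,
        Set.mem_Iio]
      constructor
      · rintro ⟨⟨k, rfl⟩, h⟩
        exact ⟨k, hx.lt_iff_gt.1 h, rfl⟩
      · rintro ⟨k, h, rfl⟩
        exact ⟨⟨k, rfl⟩, hx h⟩
    rw [this, Set.ncard_coe_finset, card_image_of_injective _ hx.injective, Fin.card_Iio]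
  have hset : {y : ℤ | (τ, y) ∈ Bset d n (chartOf x) ∧
      Set.ncard {z : ℤ | (τ, z) ∈ Bset d n (chartOf x) ∧ y < z} = i.val + 1 - 1} = {x τ i} := by
    ext y
    simp only [Set.mem_ofPred_eq, Set.mem_singleton_iff]
    constructor
    · rintro ⟨h1, h2⟩
      obtain ⟨j, rfl⟩ := (mem_Bset_chartOf hn hinj τ y).1 h1
      rw [hcard] at h2
      rw [Fin.ext (show j.val = i.val by omega)]
    · rintro rfl
      exact ⟨(mem_Bset_chartOf hn hinj τ _).2 ⟨i, rfl⟩, by rw [hcard]; rfl⟩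
  rw [btilde, hset, csInf_singleton]

lemma muOf_chartOf {d n : ℕ} (hn : 0 < n) {mfun : ZMod d → ℤ} {x : ZMod d → Fin n → ℤ}
    (hinj : ∀ τ, Function.Injective fun i => ((x τ i : ℤ) : ZMod n)) {τ : ZMod d} {i j : Fin n}
    {c : ℤ} (hc : 0 ≤ c) (h : x τ j + n * c = x (τ - 1) i + mfun (τ - 1)) :
    muOf d n mfun (chartOf x) (τ, x τ j) = c := by
  have hn' : (n : ℤ) ≠ 0 := by exact_mod_cast hn.ne'
  have hsub : x (τ - 1) i + mfun (τ - 1) - x τ j = n * c := by linarith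
  have hset : {y : ℤ | (τ - 1, y) ∈ Bset d n (chartOf x) ∧
      (y + mfun (τ - 1) - x τ j) % (n : ℤ) = 0 ∧ x τ j ≤ y + mfun (τ - 1)} = {x (τ - 1) i} := by
    ext y
    simp only [Set.mem_ofPred_eq, Set.mem_singleton_iff, mem_Bset_chartOf hn hinj]
    constructor
    · rintro ⟨⟨k, rfl⟩, h2, -⟩
      have hd : ((n : ℕ) : ℤ) ∣ x (τ - 1) k - x (τ - 1) i := by
        have h3 := Int.dvd_of_emod_eq_zero h2
        have h4 : (n : ℤ) ∣ n * c := dvd_mul_right _ _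
        rw [← hsub] at h4
        simpa using dvd_sub h3 h4
      rw [← ZMod.intCast_zmod_eq_zero_iff_dvd, Int.cast_sub, sub_eq_zero] at hd
      rw [hinj (τ - 1) hd]
    · rintro rfl
      refine ⟨⟨i, rfl⟩, by rw [hsub]; simp, ?_⟩
      have : (0 : ℤ) ≤ n * c := by positivity
      linarith
  rw [muOf, hset, csInf_singleton, hsub, Int.mul_ediv_cancel_left _ hn']

lemma strictAnti_of_step_eq {d n m : ℕ} [NeZero d] (hn : 0 < n) (hmn : Nat.Coprime m n)
    {mfun : ZMod d → ℤ} (hsum : ∑ τ, mfun τ = (m : ℤ)) {ν x : ZMod d → Fin n → ℤ}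
    (hx : step mfun ν x = x) (τ : ZMod d) : StrictAnti (x τ) := by
  refine Antitone.strictAnti_of_injective ?_ ?_
  · rw [← hx]
    exact antitone_step mfun ν x τ
  · intro i j hij
    exact (residue_bijective hn hmn hsum hx τ).1 (congrArg (Int.cast : ℤ → ZMod n) hij)

lemma exists_perm_of_step_eq {d n : ℕ} {mfun : ZMod d → ℤ} {ν x : ZMod d → Fin n → ℤ}
    (hx : step mfun ν x = x) (τ : ZMod d) : ∃ σ : Equiv.Perm (Fin n), ∀ i,
      x (τ + 1) (σ i) + n * ν (τ + 1) (σ i) = x τ i + mfun τ := by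
  refine ⟨Tuple.sort fun j => -(x (τ + 1) j + n * ν (τ + 1) j), fun i => ?_⟩
  conv_rhs => rw [← hx, step, sub_add_cancel]
  rfl

lemma cotypeTup_chartOf {d n m : ℕ} [NeZero d] (hn : 0 < n) (hmn : Nat.Coprime m n)
    {mfun : ZMod d → ℤ} (hsum : ∑ τ, mfun τ = (m : ℤ)) {ν x : ZMod d → Fin n → ℤ}
    (h0 : ∀ τ i, 0 ≤ ν τ i) (hx : step mfun ν x = x) (t : Fin d) (i : Fin n) :
    cotypeTup d n mfun (chartOf x) t i = ν ((t.val + 1 : ℕ) : ZMod d) i := by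
  have hinj := fun τ => (residue_bijective hn hmn hsum hx τ).1
  set τ := ((t.val + 1 : ℕ) : ZMod d) with hτ
  rw [cotypeTup, ← hτ, btilde_chartOf hn hinj (strictAnti_of_step_eq hn hmn hsum hx τ)]
  obtain ⟨σ, hσ⟩ := exists_perm_of_step_eq hx (τ - 1)
  refine muOf_chartOf hn hinj (i := σ.symm i) (h0 τ i) ?_
  simpa using hσ (σ.symm i)

lemma isChart_chartOf {d n : ℕ} [NeZero d] (hn : 0 < n) {mfun : ZMod d → ℤ}
    {ν x : ZMod d → Fin n → ℤ} (h0 : ∀ τ i, 0 ≤ ν τ i) (hx : step mfun ν x = x) :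
    IsChart d n mfun (chartOf x) := by
  refine ⟨⟨(0, x 0 ⟨0, hn⟩), ⟨0, hn⟩, 0, by simp⟩, ?_, ?_, ?_⟩
  · obtain ⟨c, hc⟩ := Finite.exists_ge fun p : ZMod d × Fin n => x p.1 p.2
    refine ⟨c, ?_⟩
    rintro ⟨τ, y⟩ ⟨i, N, h⟩
    have h1 : (0 : ℤ) ≤ N * n := by positivity
    have h2 := hc (τ, i)
    simp only at h h2 ⊢
    linarith
  · rintro ⟨τ, y⟩ ⟨i, N, h⟩
    obtain ⟨σ, hσ⟩ := exists_perm_of_step_eq hx τ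
    refine ⟨σ i, (ν (τ + 1) (σ i)).toNat + N, ?_⟩
    have := hσ i
    simp only at h ⊢
    rw [Nat.cast_add, Int.toNat_of_nonneg (h0 _ _)]
    linarith
  · rintro ⟨τ, y⟩ ⟨i, N, h⟩
    refine ⟨i, N + 1, ?_⟩
    simp only at h ⊢
    push_cast
    linarith

lemma add_mul_mem_of_isChart {d n : ℕ} {mfun : ZMod d → ℤ} {A : Set (ZMod d × ℤ)}
    (hA : IsChart d n mfun A) {τ : ZMod d} {y : ℤ} (h : (τ, y) ∈ A) (k : ℕ) :
    (τ, y + k * n) ∈ A := by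
  induction k with
  | zero => simpa using h
  | succ k ih =>
    have := hA.2.2.2 _ ih
    simp only at this
    rwa [show y + ((k + 1 : ℕ) : ℤ) * n = y + k * n + n by push_cast; ring]

lemma exists_add_mul_mem_of_isChart {d n m : ℕ} [NeZero d] (hn : 0 < n) (hmn : Nat.Coprime m n)
    {mfun : ZMod d → ℤ} (hsum : ∑ τ, mfun τ = (m : ℤ)) {A : Set (ZMod d × ℤ)}
    (hA : IsChart d n mfun A) (τ : ZMod d) (y : ℤ) : ∃ N : ℕ, (τ, y + N * n) ∈ A := by
  have : NeZero n := ⟨hn.ne'⟩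
  have hiter : ∀ {τ : ZMod d} {y : ℤ}, (τ, y) ∈ A → ∀ t : ℕ,
      (τ + t, y + ∑ s ∈ range t, mfun (τ + s)) ∈ A := by
    intro τ y h t
    induction t with
    | zero => simpa using h
    | succ t ih =>
      have := hA.2.2.1 _ ih
      rw [sum_range_succ, Nat.cast_succ, ← add_assoc, ← add_assoc]
      exact this
  have hm : ∀ {τ : ZMod d} {y : ℤ}, (τ, y) ∈ A → (τ, y + m) ∈ A := by
    intro τ y h
    have := hiter h d
    rwa [sum_range_natCast d fun σ => mfun (τ + σ), sum_add_left, hsum, ZMod.natCast_self,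
      add_zero] at this
  have hkm : ∀ {τ : ZMod d} {y : ℤ}, (τ, y) ∈ A → ∀ k : ℕ, (τ, y + k * m) ∈ A := by
    intro τ y h k
    induction k with
    | zero => simpa using h
    | succ k ih =>
      rw [show y + ((k + 1 : ℕ) : ℤ) * m = y + k * m + m by push_cast; ring]
      exact hm ih
  obtain ⟨⟨τ₀, y₀⟩, h₀⟩ := hA.1
  obtain ⟨y₁, h₁⟩ : ∃ y₁, (τ, y₁) ∈ A := by
    have := hiter h₀ (τ - τ₀).val
    rw [ZMod.natCast_zmod_val, add_sub_cancel] at this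
    exact ⟨_, this⟩
  set k := (((y - y₁ : ℤ) : ZMod n) * (m : ZMod n)⁻¹).val with hk
  have hdvd : ((n : ℕ) : ℤ) ∣ y - (y₁ + k * m) := by
    rw [← ZMod.intCast_zmod_eq_zero_iff_dvd]
    push_cast
    rw [hk, ZMod.natCast_zmod_val, mul_assoc, mul_comm _ (m : ZMod n),
      ZMod.coe_mul_inv_eq_one m hmn]
    push_cast
    ring
  obtain ⟨q, hq⟩ := hdvd
  refine ⟨q.natAbs, ?_⟩
  have h2 := add_mul_mem_of_isChart hA (hkm h₁ k) (q + q.natAbs).toNat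
  rw [Int.toNat_of_nonneg (by omega)] at h2
  rwa [show y + (q.natAbs : ℤ) * n = y₁ + k * m + (q + q.natAbs) * n by linarith]

lemma exists_eq_chartOf {d n m : ℕ} [NeZero d] (hn : 0 < n) (hmn : Nat.Coprime m n)
    {mfun : ZMod d → ℤ} (hsum : ∑ τ, mfun τ = (m : ℤ)) {A : Set (ZMod d × ℤ)}
    (hA : IsChart d n mfun A) : ∃ x : ZMod d → Fin n → ℤ, (∀ τ, Antitone (x τ)) ∧
      (∀ τ, Function.Injective fun i => ((x τ i : ℤ) : ZMod n)) ∧ A = chartOf x := by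
  have : NeZero n := ⟨hn.ne'⟩
  have hleast : ∀ (τ : ZMod d) (r : Fin n), ∃ g : ℤ,
      ((τ, g) ∈ A ∧ (g : ZMod n) = (r.val : ZMod n)) ∧
      ∀ y, (τ, y) ∈ A ∧ (y : ZMod n) = (r.val : ZMod n) → g ≤ y := by
    intro τ r
    obtain ⟨c, hc⟩ := hA.2.1
    refine Int.exists_least_of_bdd ⟨c, fun y hy => hc _ hy.1⟩ ?_
    obtain ⟨N, hN⟩ := exists_add_mul_mem_of_isChart hn hmn hsum hA τ r.val
    exact ⟨_, hN, by simp⟩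
  choose g hg hgle using hleast
  refine ⟨fun τ => sortDesc (g τ), fun τ => antitone_sortDesc _, ?_, ?_⟩
  · intro τ i j hij
    simp only [sortDesc, Function.comp, (hg _ _).2] at hij
    exact (Tuple.sort fun j => -(g τ j)).injective ((bijective_natCast_fin n).1 hij)
  · ext ⟨τ, y⟩
    constructor
    · intro hy
      obtain ⟨r, hr⟩ := (bijective_natCast_fin n).2 (y : ZMod n)
      have hle := hgle τ r y ⟨hy, hr.symm⟩
      have hdvd : ((n : ℕ) : ℤ) ∣ y - g τ r := by
        rw [← ZMod.intCast_zmod_eq_zero_iff_dvd, Int.cast_sub, (hg τ r).2, sub_eq_zero]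
        exact hr.symm
      obtain ⟨q, hq⟩ := hdvd
      have hq0 : 0 ≤ q := by
        by_contra! h
        have : (n : ℤ) * q < 0 := mul_neg_of_pos_of_neg (by exact_mod_cast hn) h
        linarith
      refine ⟨(Tuple.sort fun j => -(g τ j)).symm r, q.toNat, ?_⟩
      simp only [sortDesc, Function.comp, Equiv.apply_symm_apply, Int.toNat_of_nonneg hq0]
      linarith
    · rintro ⟨i, N, h⟩
      simp only at h
      rw [h]
      exact add_mul_mem_of_isChart hA (hg τ _).1 N

lemma exists_step_eq_of_isChart {d n m : ℕ} [NeZero d] (hn : 0 < n) (hmn : Nat.Coprime m n)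
    {mfun : ZMod d → ℤ} (hsum : ∑ τ, mfun τ = (m : ℤ)) {A : Set (ZMod d × ℤ)}
    (hA : IsChart d n mfun A) : ∃ ν x : ZMod d → Fin n → ℤ, (∀ τ i, 0 ≤ ν τ i) ∧
      step mfun ν x = x ∧ A = chartOf x := by
  obtain ⟨x, hanti, hinj, rfl⟩ := exists_eq_chartOf hn hmn hsum hA
  have hsucc : ∀ τ i, ∃ j, ∃ N : ℕ, x τ i + mfun τ = x (τ + 1) j + N * n := fun τ i =>
    hA.2.2.1 (τ, x τ i) ⟨i, 0, by simp⟩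
  choose π N hN using hsucc
  have hπ : ∀ τ, Function.Bijective (π τ) := fun τ =>
    Finite.injective_iff_bijective.1 fun i j hij => hinj τ (by
      have hi := congrArg (Int.cast : ℤ → ZMod n) (hN τ i)
      have hj := congrArg (Int.cast : ℤ → ZMod n) (hN τ j)
      push_cast at hi hj
      rw [hij] at hi
      simp only [CharP.cast_eq_zero, mul_zero, add_zero] at hi hj
      exact add_right_cancel (hi.trans hj.symm))
  set σ : ZMod d → Equiv.Perm (Fin n) := fun τ => Equiv.ofBijective (π τ) (hπ τ) with hσ
  refine ⟨fun τ j => N (τ - 1) ((σ (τ - 1)).symm j), x, fun τ i => by positivity, ?_, rfl⟩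
  funext τ i
  have : sortDesc (fun j => x (τ + 1) j +
      n * (fun τ j => (N (τ - 1) ((σ (τ - 1)).symm j) : ℤ)) (τ + 1) j) =
      fun i => x τ i + mfun τ := by
    refine sortDesc_eq_of_comp_perm (fun _ _ h => add_le_add_left (hanti τ h) _) (σ τ).symm
      fun j => ?_
    have h1 : π τ ((σ τ).symm j) = j := (σ τ).apply_symm_apply j
    simp only [add_sub_cancel_right]
    rw [hN, h1]
    ring
  rw [step, this, add_sub_cancel_right]

lemma shift_chartOf {d n : ℕ} (x : ZMod d → Fin n → ℤ) (z : ℤ) :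
    shift d (chartOf x) z = chartOf fun τ i => x τ i + z := by
  ext ⟨τ, y⟩
  constructor
  · rintro ⟨⟨τ', y'⟩, ⟨i, N, h⟩, h'⟩
    obtain ⟨rfl, rfl⟩ := Prod.mk.inj h'
    refine ⟨i, N, ?_⟩
    simp only at h ⊢
    linarith
  · rintro ⟨i, N, h⟩
    refine ⟨(τ, y - z), ⟨i, N, ?_⟩, by simp⟩
    simp only at h ⊢
    linarith

lemma memP_iff {d n m : ℕ} [NeZero d] (ν : ZMod d → Fin n → ℤ) :
    memP d n m (fun t i => ν ((t.val + 1 : ℕ) : ZMod d) i) ↔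
      (∀ τ i, 0 ≤ ν τ i) ∧ (∀ k ≤ n, (n : ℤ) * ∑ τ, topSum k (ν τ) ≤ k * m) ∧
        ∑ τ, ∑ i, ν τ i = (m : ℤ) := by
  have htop : ∀ k, ∑ t : Fin d, ∑ i : Fin n,
      (if i.val + 1 ≤ k then ν ((t.val + 1 : ℕ) : ZMod d) i else 0) = ∑ τ, topSum k (ν τ) := by
    intro k
    rw [← sum_fin_natCast_succ]
    simp only [topSum, sum_filter, Nat.succ_le_iff]
  unfold memP
  rw [sum_fin_natCast_succ d fun τ => ∑ i, ν τ i]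
  simp only [htop]
  refine and_congr ⟨fun h τ i => ?_, fun h t i => h _ i⟩ (and_congr_left fun _ => ?_)
  · obtain ⟨t, rfl⟩ := exists_natCast_succ_eq τ
    exact h t i
  · refine ⟨fun h k hk => ?_, fun h k _ hk => h k hk⟩
    rcases Nat.eq_zero_or_pos k with rfl | hk0
    · simp [topSum_zero]
    · exact h k hk0 hk

lemma exists_eq_comp_natCast_succ {d n : ℕ} [NeZero d] (μ : Fin d → Fin n → ℤ) :
    ∃ ν : ZMod d → Fin n → ℤ, μ = fun t i => ν ((t.val + 1 : ℕ) : ZMod d) i := by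
  refine ⟨fun τ => μ ((Equiv.ofBijective _ (bijective_natCast_fin d)).symm (τ - 1)), ?_⟩
  funext t i
  have : (Equiv.ofBijective _ (bijective_natCast_fin d)).symm
      (((t.val + 1 : ℕ) : ZMod d) - 1) = t := by
    rw [Equiv.symm_apply_eq]
    simp
  simp only [this]

end ELChart

open ELChart

/-- The assignment `A ↦ cotype A` induces a bijection from the set of
equivalence classes of EL-charts onto `P_{m,n,d}` : the cotype is invariant under equivalence,
it lies in `P_{m,n,d}`, two EL-charts with the same cotype are equivalent, and every element
of `P_{m,n,d}` is the cotype of some EL-chart. -/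
theorem cotype_bijection_classes_P
    (d n m : ℕ) [NeZero d] (hn : 0 < n) (hm : 0 < m) (hmn : Nat.Coprime m n)
    (mfun : ZMod d → ℤ) (hsum : ∑ τ : ZMod d, mfun τ = (m : ℤ)) :
    (∀ A A' : Set (ZMod d × ℤ), IsChart d n mfun A → IsChart d n mfun A' →
      ChartEquiv d A A' → cotypeTup d n mfun A = cotypeTup d n mfun A') ∧
    (∀ A : Set (ZMod d × ℤ), IsChart d n mfun A → memP d n m (cotypeTup d n mfun A)) ∧
    (∀ A A' : Set (ZMod d × ℤ), IsChart d n mfun A → IsChart d n mfun A' →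
      cotypeTup d n mfun A = cotypeTup d n mfun A' → ChartEquiv d A A') ∧
    (∀ μ : Fin d → Fin n → ℤ, memP d n m μ →
      ∃ A : Set (ZMod d × ℤ), IsChart d n mfun A ∧ cotypeTup d n mfun A = μ) := by
  have hcot : ∀ {ν x : ZMod d → Fin n → ℤ}, (∀ τ i, 0 ≤ ν τ i) → step mfun ν x = x →
      cotypeTup d n mfun (chartOf x) = fun t i => ν ((t.val + 1 : ℕ) : ZMod d) i :=
    fun h0 hx => funext fun t => funext fun i => cotypeTup_chartOf hn hmn hsum h0 hx t i
  refine ⟨?_, ?_, ?_, ?_⟩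
  · rintro A A' hA - ⟨z, rfl⟩
    obtain ⟨ν, x, h0, hx, rfl⟩ := exists_step_eq_of_isChart hn hmn hsum hA
    rw [shift_chartOf, hcot h0 hx, hcot h0 (by rw [step_add_const, hx])]
  · intro A hA
    obtain ⟨ν, x, h0, hx, rfl⟩ := exists_step_eq_of_isChart hn hmn hsum hA
    rw [hcot h0 hx, memP_iff]
    exact ⟨h0, fun k hk => sum_topSum_le_of_step_eq hk hsum hx,
      (sum_eq_of_step_eq hn hx).trans hsum⟩
  · intro A A' hA hA' h
    obtain ⟨ν, x, h0, hx, rfl⟩ := exists_step_eq_of_isChart hn hmn hsum hA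
    obtain ⟨ν', x', h0', hx', rfl⟩ := exists_step_eq_of_isChart hn hmn hsum hA'
    rw [hcot h0 hx, hcot h0' hx'] at h
    obtain rfl : ν = ν' := by
      funext τ
      obtain ⟨t, rfl⟩ := exists_natCast_succ_eq τ
      exact congrFun h t
    obtain ⟨c, rfl⟩ := exists_eq_add_of_step_eq hn hmn hsum hx' hx
    exact ⟨c, shift_chartOf x c⟩
  · intro μ hμ
    obtain ⟨ν, rfl⟩ := exists_eq_comp_natCast_succ μ
    obtain ⟨h0, hP, htot⟩ := (memP_iff ν).1 hμ
    obtain ⟨x, hx⟩ := exists_step_eq hn hsum h0 htot hP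
    exact ⟨chartOf x, isChart_chartOf hn h0 hx, hcot h0 hx⟩
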